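/- arXiv:2406.01295 — 7 statements merged into one kernel-verified Lean document; each statement's English description precedes it below -/
import Mathlib

section
/- Define sequences p, q : ℕ → ℝ by p 0 = 1, q 0 = 1, p 1 = 4, q 1 = 3, and for all n ≥ 2, p n = (2n+1)·p (n−1) + n²·p (n−2) and q n = (2n+1)·q (n−1) + n²·q (n−2). Then the sequence p n / q n converges to 4/π. -/
/-- The integral `∫ (√2 cos ψ - 1) ^ n` over `[0, π / 4]`, a Laplace-type integral for the minimal
solution of the Legendre recurrence at `i`. -/
noncomputable def laplaceIntegral (n : ℕ) : ℝ :=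
  ∫ x in (0 : ℝ)..(Real.pi / 4), (√2 * Real.cos x - 1) ^ n

theorem laplaceIntegral_zero : laplaceIntegral 0 = Real.pi / 4 := by
  simp [laplaceIntegral]

theorem laplaceIntegral_one : laplaceIntegral 1 = 1 - Real.pi / 4 := by
  have h : √2 * (√2 / 2) = 1 := by
    rw [← mul_div_assoc, Real.mul_self_sqrt (by norm_num)]
    norm_num
  simp only [laplaceIntegral, pow_one]
  rw [intervalIntegral.integral_sub (by apply Continuous.intervalIntegrable; fun_prop) (by simp),
    intervalIntegral.integral_const_mul]
  simp [h]

theorem laplaceIntegral_succ_succ (n : ℕ) :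
    (n + 2) * laplaceIntegral (n + 2) + (2 * n + 3) * laplaceIntegral (n + 1)
      - (n + 1) * laplaceIntegral n = 0 := by
  have hs : √2 * √2 = 2 := Real.mul_self_sqrt (by norm_num)
  have hi (m : ℕ) : IntervalIntegrable (fun x : ℝ => (√2 * Real.cos x - 1) ^ m)
      MeasureTheory.volume 0 (Real.pi / 4) := by
    apply Continuous.intervalIntegrable
    fun_prop
  have hderiv (x : ℝ) : HasDerivAt (fun x => (√2 * Real.cos x - 1) ^ (n + 1) * (√2 * Real.sin x))
      ((n + 2) * (√2 * Real.cos x - 1) ^ (n + 2) + (2 * n + 3) * (√2 * Real.cos x - 1) ^ (n + 1)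
        - (n + 1) * (√2 * Real.cos x - 1) ^ n) x := by
    have h := ((((Real.hasDerivAt_cos x).const_mul √2).sub_const 1).pow (n + 1)).mul
      ((Real.hasDerivAt_sin x).const_mul √2)
    refine h.congr_deriv ?_
    simp only [Pi.pow_apply, Nat.add_sub_cancel, Nat.cast_add, Nat.cast_one, pow_succ]
    linear_combination (-(n + 1) * (√2 * Real.cos x - 1) ^ n * (√2 * √2)) *
      Real.sin_sq_add_cos_sq x - (n + 1) * (√2 * Real.cos x - 1) ^ n * hs
  have hint := intervalIntegral.integral_eq_sub_of_hasDerivAt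
    (a := 0) (b := Real.pi / 4) (fun x _ => hderiv x)
    ((((hi _).const_mul _).add ((hi _).const_mul _)).sub ((hi _).const_mul _))
  rw [intervalIntegral.integral_sub (((hi _).const_mul _).add ((hi _).const_mul _))
      ((hi _).const_mul _),
    intervalIntegral.integral_add ((hi _).const_mul _) ((hi _).const_mul _),
    intervalIntegral.integral_const_mul, intervalIntegral.integral_const_mul,
    intervalIntegral.integral_const_mul] at hint
  have hb : √2 * (√2 / 2) - 1 = 0 := by linarith
  simpa [laplaceIntegral, hb] using hint

theorem abs_laplaceIntegral_le (n : ℕ) :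
    |laplaceIntegral n| ≤ (1 / 2) ^ n * (Real.pi / 4) := by
  have hs : √2 * √2 = 2 := Real.mul_self_sqrt (by norm_num)
  have hs0 : 0 ≤ √2 := Real.sqrt_nonneg 2
  have h := intervalIntegral.norm_integral_le_of_norm_le_const
    (a := 0) (b := Real.pi / 4) (f := fun x => (√2 * Real.cos x - 1) ^ n) (C := (1 / 2) ^ n) ?_
  · rwa [sub_zero, abs_of_pos (by positivity)] at h
  · intro x hx
    rw [Set.uIoc_of_le (by positivity)] at hx
    have hc : √2 / 2 ≤ Real.cos x := by
      rw [← Real.cos_pi_div_four]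
      exact Real.cos_le_cos_of_nonneg_of_le_pi hx.1.le (by linarith [Real.pi_pos]) hx.2
    have hc1 := Real.cos_le_one x
    rw [norm_pow, Real.norm_eq_abs]
    gcongr
    rw [abs_le]
    constructor <;> nlinarith

theorem pi_cf_convergents_tendsto
    (p q : ℕ → ℝ)
    (hp0 : p 0 = 1) (hq0 : q 0 = 1) (hp1 : p 1 = 4) (hq1 : q 1 = 3)
    (hp : ∀ n : ℕ, 2 ≤ n → p n = (2 * n + 1) * p (n - 1) + (n : ℝ) ^ 2 * p (n - 2))
    (hq : ∀ n : ℕ, 2 ≤ n → q n = (2 * n + 1) * q (n - 1) + (n : ℝ) ^ 2 * q (n - 2)) :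
    Filter.Tendsto (fun n => p n / q n) Filter.atTop (nhds (4 / Real.pi)) := by
  have hp' (n : ℕ) : p (n + 2) = (2 * n + 5) * p (n + 1) + ((n : ℝ) + 2) ^ 2 * p n := by
    have := hp (n + 2) (by omega)
    simp only [Nat.add_sub_cancel, show n + 2 - 1 = n + 1 by omega] at this
    rw [this]; push_cast; ring
  have hq' (n : ℕ) : q (n + 2) = (2 * n + 5) * q (n + 1) + ((n : ℝ) + 2) ^ 2 * q n := by
    have := hq (n + 2) (by omega)
    simp only [Nat.add_sub_cancel, show n + 2 - 1 = n + 1 by omega] at this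
    rw [this]; push_cast; ring
  have hfact (n : ℕ) : ((n + 1).factorial : ℝ) = (n + 1) * n.factorial := by
    rw [Nat.factorial_succ]; push_cast; ring
  have hlow (n : ℕ) : ((n + 1).factorial : ℝ) ≤ p n := by
    induction n using Nat.twoStepInduction with
    | zero => simp [hp0]
    | one => rw [hp1]; norm_num [Nat.factorial]
    | more n h0 h1 =>
      have hpn : 0 ≤ p n := le_trans (by positivity) h0
      rw [hp', hfact (n + 2)]
      push_cast
      have : ((n : ℝ) + 2 + 1) * (n + 2).factorial ≤ (2 * n + 5) * p (n + 1) := by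
        refine mul_le_mul ?_ h1 (by positivity) (by positivity)
        linarith [n.cast_nonneg (α := ℝ)]
      nlinarith [mul_nonneg (sq_nonneg ((n : ℝ) + 2)) hpn]
  have herr (n : ℕ) : q n = Real.pi / 4 * p n +
      (-1) ^ n * (n + 1).factorial * laplaceIntegral (n + 1) := by
    induction n using Nat.twoStepInduction with
    | zero => simp [hp0, hq0, laplaceIntegral_one]
    | one =>
      have := laplaceIntegral_succ_succ 0
      simp only [laplaceIntegral_zero, zero_add, laplaceIntegral_one, Nat.cast_zero] at this
      norm_num [hp1, hq1, Nat.factorial]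
      linarith
    | more n h0 h1 =>
      have h := laplaceIntegral_succ_succ (n + 1)
      push_cast at h
      rw [hp', hq', h0, h1, hfact (n + 2), hfact (n + 1)]
      push_cast
      rw [pow_succ, pow_succ]
      linear_combination (-(-1) ^ n * ((n : ℝ) + 2) * (n + 1).factorial) * h
  have hpow : Filter.Tendsto (fun n : ℕ => (1 / 2 : ℝ) ^ (n + 1) * (Real.pi / 4))
      Filter.atTop (nhds 0) := by
    simpa using ((Filter.tendsto_add_atTop_iff_nat 1).2
      (tendsto_pow_atTop_nhds_zero_of_lt_one (r := (1 / 2 : ℝ)) (by norm_num)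
        (by norm_num))).mul_const (Real.pi / 4)
  have hlim : Filter.Tendsto (fun n => q n / p n) Filter.atTop (nhds (Real.pi / 4)) := by
    rw [tendsto_iff_norm_sub_tendsto_zero]
    refine squeeze_zero (fun _ => norm_nonneg _) (fun n => ?_) hpow
    have hpos : 0 < p n := lt_of_lt_of_le (by positivity) (hlow n)
    have heq : q n / p n - Real.pi / 4 =
        (-1) ^ n * (n + 1).factorial * laplaceIntegral (n + 1) / p n := by
      rw [herr n]; field_simp; ring
    rw [heq, Real.norm_eq_abs, abs_div, abs_mul, abs_mul, abs_pow, abs_neg, abs_one, one_pow,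
      one_mul, Nat.abs_cast, abs_of_pos hpos, div_le_iff₀ hpos, mul_comm]
    exact mul_le_mul (abs_laplaceIntegral_le _) (hlow n) (by positivity) (by positivity)
  simpa using hlim.inv₀ (by positivity)
end

section
/- Define sequences p, q : ℕ → ℝ by p 0 = 1, q 0 = 1, p 1 = 4, q 1 = 3, and for all n ≥ 2, p n = (2n+1)·p (n−1) + n²·p (n−2) and q n = (2n+1)·q (n−1) + n²·q (n−2). Then there exists a constant C > 0 such that for all n ≥ 1, |p n / q n − 4/π| ≤ C·(1+√2)^(−2n). -/
/-- If `u = √2 s / (s² + √2 s + 1)`, these are the integrands `√2 uⁿ / (s² + √2 s + 1)`. Under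
`s = exp (-θ)` their integrals over `[0, 1]` become Heine's integrals
`∫ (1 + √2 cosh θ)⁻ⁿ⁻¹ dθ` for the Legendre functions of the second kind. -/
noncomputable def heineIntegrand (n : ℕ) (s : ℝ) : ℝ :=
  √2 * (√2 * s / (s ^ 2 + √2 * s + 1)) ^ n / (s ^ 2 + √2 * s + 1)

noncomputable def heineIntegral (n : ℕ) : ℝ := ∫ s in (0 : ℝ)..1, heineIntegrand n s

lemma heine_denom_pos (s : ℝ) : 0 < s ^ 2 + √2 * s + 1 := by
  have h2 : √2 ^ 2 = 2 := Real.sq_sqrt (by norm_num)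
  nlinarith [sq_nonneg (2 * s + √2)]

lemma continuous_heineIntegrand (n : ℕ) : Continuous (heineIntegrand n) := by
  unfold heineIntegrand
  have h : ∀ s : ℝ, s ^ 2 + √2 * s + 1 ≠ 0 := fun s => (heine_denom_pos s).ne'
  fun_prop (disch := exact h _)

lemma intervalIntegrable_heineIntegrand (n : ℕ) :
    IntervalIntegrable (heineIntegrand n) MeasureTheory.volume 0 1 :=
  (continuous_heineIntegrand n).intervalIntegrable 0 1

lemma heineIntegral_nonneg (n : ℕ) : 0 ≤ heineIntegral n := by
  refine intervalIntegral.integral_nonneg zero_le_one fun s hs => ?_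
  have := heine_denom_pos s
  have := hs.1
  unfold heineIntegrand
  positivity

lemma hasDerivAt_heine_denom (s : ℝ) :
    HasDerivAt (fun s : ℝ => s ^ 2 + √2 * s + 1) (2 * s + √2) s := by
  simpa using (((hasDerivAt_id s).pow 2).add ((hasDerivAt_id s).const_mul √2)).add_const 1

lemma hasDerivAt_one_sub_sq_div_heine_denom (s : ℝ) :
    HasDerivAt (fun s : ℝ => (1 - s ^ 2) / (s ^ 2 + √2 * s + 1))
      ((-(2 * s) * (s ^ 2 + √2 * s + 1) - (1 - s ^ 2) * (2 * s + √2)) /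
        (s ^ 2 + √2 * s + 1) ^ 2) s := by
  have h : HasDerivAt (fun s : ℝ => 1 - s ^ 2) (-(2 * s)) s := by
    simpa using ((hasDerivAt_id s).pow 2).const_sub 1
  exact h.div (hasDerivAt_heine_denom s) (heine_denom_pos s).ne'

lemma heineIntegral_zero : heineIntegral 0 = Real.pi / 4 := by
  have h2 : √2 ^ 2 = 2 := Real.sq_sqrt (by norm_num)
  have hd : ∀ s : ℝ, HasDerivAt (fun s => 2 * Real.arctan (√2 * s + 1)) (heineIntegrand 0 s) s := by
    intro s
    have h := ((((hasDerivAt_id s).const_mul √2).add_const 1).arctan).const_mul 2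
    refine h.congr_deriv ?_
    have := heine_denom_pos s
    have h1 : 1 + (√2 * s + 1) ^ 2 = 2 * (s ^ 2 + √2 * s + 1) := by
      linear_combination s ^ 2 * h2
    simp only [id, heineIntegrand, h1]
    field_simp
  have hpi : Real.arctan (√2 + 1) = 3 * Real.pi / 8 := by
    have hinv : (√2 + 1)⁻¹ = √2 - 1 := by
      refine inv_eq_of_mul_eq_one_left ?_
      linear_combination h2
    have hlt : (1 : ℝ) < √2 := by rw [Real.lt_sqrt] <;> norm_num
    have hinv' := Real.arctan_inv_of_pos (x := √2 + 1) (by positivity)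
    have hadd := Real.arctan_add (x := √2 - 1) (y := √2 - 1) (by nlinarith)
    have hone : (√2 - 1 + (√2 - 1)) / (1 - (√2 - 1) * (√2 - 1)) = 1 := by
      rw [div_eq_one_iff_eq (by nlinarith)]
      linear_combination h2
    rw [hone, Real.arctan_one] at hadd
    rw [hinv] at hinv'
    linarith
  rw [heineIntegral, intervalIntegral.integral_eq_sub_of_hasDerivAt (fun s _ => hd s)
    (intervalIntegrable_heineIntegrand 0)]
  simp only [mul_one, mul_zero, zero_add, hpi, Real.arctan_one]
  ring

lemma heineIntegral_one : heineIntegral 1 = 1 - Real.pi / 4 := by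
  have h2 : √2 ^ 2 = 2 := Real.sq_sqrt (by norm_num)
  have hd : ∀ s : ℝ, HasDerivAt (fun s : ℝ => (1 - s ^ 2) / (s ^ 2 + √2 * s + 1))
      (-(heineIntegrand 0 s + heineIntegrand 1 s)) s := by
    intro s
    convert hasDerivAt_one_sub_sq_div_heine_denom s using 1
    have := heine_denom_pos s
    simp only [heineIntegrand]
    generalize hE : s ^ 2 + √2 * s + 1 = E at this ⊢
    field_simp
    subst hE
    linear_combination (-2 * s) * h2
  have h := intervalIntegral.integral_eq_sub_of_hasDerivAt (fun s _ => hd s)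
    ((intervalIntegrable_heineIntegrand 0).add (intervalIntegrable_heineIntegrand 1)).neg
  rw [intervalIntegral.integral_neg, intervalIntegral.integral_add
    (intervalIntegrable_heineIntegrand 0) (intervalIntegrable_heineIntegrand 1)] at h
  change -(heineIntegral 0 + heineIntegral 1) = _ at h
  norm_num [heineIntegral_zero] at h
  linarith

lemma heineIntegral_add_two (n : ℕ) :
    (n + 2) * heineIntegral (n + 2) =
      (n + 1) * heineIntegral n - (2 * n + 3) * heineIntegral (n + 1) := by
  have h2 : √2 ^ 2 = 2 := Real.sq_sqrt (by norm_num)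
  have hd : ∀ s : ℝ, HasDerivAt (fun s : ℝ => (√2 * s / (s ^ 2 + √2 * s + 1)) ^ (n + 1) *
      ((1 - s ^ 2) / (s ^ 2 + √2 * s + 1)))
      ((n + 1) * heineIntegrand n s - (2 * n + 3) * heineIntegrand (n + 1) s -
        (n + 2) * heineIntegrand (n + 2) s) s := by
    intro s
    have hD := heine_denom_pos s
    have hu : HasDerivAt (fun s : ℝ => √2 * s / (s ^ 2 + √2 * s + 1))
        (√2 * (1 - s ^ 2) / (s ^ 2 + √2 * s + 1) ^ 2) s := by
      refine (((hasDerivAt_id s).const_mul √2).div (hasDerivAt_heine_denom s) hD.ne').congr_deriv ?_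
      simp only [id]
      ring
    refine ((hu.pow (n + 1)).mul (hasDerivAt_one_sub_sq_div_heine_denom s)).congr_deriv ?_
    simp only [heineIntegrand, Pi.pow_apply, Nat.add_sub_cancel, pow_add _ n]
    generalize (√2 * s / (s ^ 2 + √2 * s + 1)) ^ n = w
    generalize hE : s ^ 2 + √2 * s + 1 = E at hD ⊢
    push_cast
    field_simp
    subst hE
    linear_combination (2 * w * s ^ 2 * (n + 2)) * h2
  have i0 := (intervalIntegrable_heineIntegrand n).const_mul ((n : ℝ) + 1)
  have i1 := (intervalIntegrable_heineIntegrand (n + 1)).const_mul (2 * (n : ℝ) + 3)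
  have i2 := (intervalIntegrable_heineIntegrand (n + 2)).const_mul ((n : ℝ) + 2)
  have h := intervalIntegral.integral_eq_sub_of_hasDerivAt (fun s _ => hd s) ((i0.sub i1).sub i2)
  rw [intervalIntegral.integral_sub (i0.sub i1) i2, intervalIntegral.integral_sub i0 i1] at h
  simp only [intervalIntegral.integral_const_mul] at h
  change (n + 1) * heineIntegral n - (2 * n + 3) * heineIntegral (n + 1) -
    (n + 2) * heineIntegral (n + 2) = _ at h
  norm_num at h
  linarith

section Recurrence

variable {p q : ℕ → ℝ}

lemma neg_one_pow_mul_sub_eq_factorial_mul_heineIntegral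
    (hp0 : p 0 = 1) (hq0 : q 0 = 1) (hp1 : p 1 = 4) (hq1 : q 1 = 3)
    (hp : ∀ n : ℕ, p (n + 2) = (2 * n + 5) * p (n + 1) + ((n : ℝ) + 2) ^ 2 * p n)
    (hq : ∀ n : ℕ, q (n + 2) = (2 * n + 5) * q (n + 1) + ((n : ℝ) + 2) ^ 2 * q n) (n : ℕ) :
    (-1) ^ n * (q n - Real.pi / 4 * p n) = (n + 1).factorial * heineIntegral (n + 1) := by
  induction n using Nat.twoStepInduction with
  | zero => simp [hp0, hq0, heineIntegral_one]
  | one =>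
    have h := heineIntegral_add_two 0
    norm_num [heineIntegral_zero, heineIntegral_one] at h
    norm_num [hp1, hq1, h]
    ring
  | more n ih₀ ih₁ =>
    have h := heineIntegral_add_two (n + 1)
    rw [hp, hq, Nat.factorial_succ (n + 2)]
    rw [Nat.factorial_succ (n + 1)] at ih₁ ⊢
    push_cast at h ih₁ ⊢
    rw [pow_succ] at ih₁
    rw [pow_add]
    linear_combination (-(2 * (n : ℝ) + 5)) * ih₁ + ((n : ℝ) + 2) ^ 2 * ih₀ -
      ((n : ℝ) + 2) * (n + 1).factorial * h

lemma casoratian_eq_neg_one_pow_mul_factorial_sq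
    (hp0 : p 0 = 1) (hq0 : q 0 = 1) (hp1 : p 1 = 4) (hq1 : q 1 = 3)
    (hp : ∀ n : ℕ, p (n + 2) = (2 * n + 5) * p (n + 1) + ((n : ℝ) + 2) ^ 2 * p n)
    (hq : ∀ n : ℕ, q (n + 2) = (2 * n + 5) * q (n + 1) + ((n : ℝ) + 2) ^ 2 * q n) (n : ℕ) :
    p (n + 1) * q n - p n * q (n + 1) = (-1) ^ n * ((n + 1).factorial : ℝ) ^ 2 := by
  induction n with
  | zero => norm_num [hp0, hq0, hp1, hq1]
  | succ n ih =>
    rw [hp, hq, Nat.factorial_succ (n + 1)]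
    push_cast
    linear_combination (-((n : ℝ) + 2) ^ 2) * ih

/-- A subsolution of the recurrence satisfied by the denominators. -/
noncomputable def denomLowerBound : ℕ → ℝ
  | 0 => 1 / 2
  | n + 1 => (1 + √2) * (n + 3 / 2) * denomLowerBound n

lemma denomLowerBound_pos (n : ℕ) : 0 < denomLowerBound n := by
  induction n with
  | zero => norm_num [denomLowerBound]
  | succ n ih => rw [denomLowerBound]; positivity

lemma denomLowerBound_le (hq0 : q 0 = 1) (hq1 : q 1 = 3)
    (hq : ∀ n : ℕ, q (n + 2) = (2 * n + 5) * q (n + 1) + ((n : ℝ) + 2) ^ 2 * q n) (n : ℕ) :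
    denomLowerBound n ≤ q n := by
  have h2 : √2 ^ 2 = 2 := Real.sq_sqrt (by norm_num)
  induction n using Nat.twoStepInduction with
  | zero => norm_num [denomLowerBound, hq0]
  | one =>
    have : √2 ≤ 2 := by rw [Real.sqrt_le_left] <;> norm_num
    norm_num [denomLowerBound, hq1]
    linarith
  | more n ih₀ ih₁ =>
    have hb := denomLowerBound_pos n
    have hle : denomLowerBound (n + 2) ≤ (2 * n + 5) * denomLowerBound (n + 1) +
        ((n : ℝ) + 2) ^ 2 * denomLowerBound n := by
      simp only [denomLowerBound]
      push_cast
      have : (2 * n + 5) * ((1 + √2) * (n + 3 / 2) * denomLowerBound n) +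
          ((n : ℝ) + 2) ^ 2 * denomLowerBound n -
          (1 + √2) * (n + 1 + 3 / 2) * ((1 + √2) * (n + 3 / 2) * denomLowerBound n) =
          denomLowerBound n / 4 := by
        linear_combination
          (-((n : ℝ) + 5 / 2) * (n + 3 / 2) * denomLowerBound n) * h2
      linarith
    rw [hq]
    refine hle.trans ?_
    gcongr

lemma pow_mul_factorial_le_denomLowerBound_sq (n : ℕ) :
    (1 + √2) ^ (2 * n) * (n.factorial * (n + 1).factorial) ≤ 4 * denomLowerBound n ^ 2 := by
  induction n with
  | zero => norm_num [denomLowerBound]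
  | succ n ih =>
    rw [Nat.factorial_succ (n + 1), Nat.factorial_succ n] at *
    rw [denomLowerBound]
    push_cast at ih ⊢
    calc (1 + √2) ^ (2 * (n + 1)) * (((n : ℝ) + 1) * n.factorial *
          ((n + 1 + 1) * ((n + 1) * n.factorial)))
        = ((1 + √2) ^ 2 * ((n + 1) * (n + 2))) *
          ((1 + √2) ^ (2 * n) * (n.factorial * ((n + 1) * n.factorial))) := by ring
      _ ≤ ((1 + √2) ^ 2 * (n + 3 / 2) ^ 2) * (4 * denomLowerBound n ^ 2) := by
        gcongr
        nlinarith
      _ = _ := by ring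

lemma pow_mul_factorial_sq_le_mul (hq0 : q 0 = 1) (hq1 : q 1 = 3)
    (hq : ∀ n : ℕ, q (n + 2) = (2 * n + 5) * q (n + 1) + ((n : ℝ) + 2) ^ 2 * q n) (n : ℕ) :
    (1 + √2) ^ (2 * n) * ((n + 1).factorial : ℝ) ^ 2 ≤ 4 * (q n * q (n + 1)) := by
  have hb := denomLowerBound_pos n
  have h0 := denomLowerBound_le hq0 hq1 hq n
  have h1 := denomLowerBound_le hq0 hq1 hq (n + 1)
  have hsq := pow_mul_factorial_le_denomLowerBound_sq n
  have hstep : (n + 1) * denomLowerBound n ≤ denomLowerBound (n + 1) := by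
    rw [denomLowerBound]
    gcongr
    nlinarith [Real.sqrt_nonneg 2, mul_nonneg (Real.sqrt_nonneg 2) (n.cast_nonneg (α := ℝ))]
  calc (1 + √2) ^ (2 * n) * ((n + 1).factorial : ℝ) ^ 2
      = (n + 1) * ((1 + √2) ^ (2 * n) * (n.factorial * (n + 1).factorial)) := by
        rw [Nat.factorial_succ]; push_cast; ring
    _ ≤ (n + 1) * (4 * denomLowerBound n ^ 2) := by gcongr
    _ = 4 * (denomLowerBound n * ((n + 1) * denomLowerBound n)) := by ring
    _ ≤ 4 * (q n * q (n + 1)) := by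
      gcongr
      exact hb.le.trans h0
      exact hstep.trans h1

end Recurrence

theorem pi_cf_convergents_rate
    (p q : ℕ → ℝ)
    (hp0 : p 0 = 1) (hq0 : q 0 = 1) (hp1 : p 1 = 4) (hq1 : q 1 = 3)
    (hp : ∀ n : ℕ, 2 ≤ n → p n = (2 * n + 1) * p (n - 1) + (n : ℝ) ^ 2 * p (n - 2))
    (hq : ∀ n : ℕ, 2 ≤ n → q n = (2 * n + 1) * q (n - 1) + (n : ℝ) ^ 2 * q (n - 2)) :
    ∃ C : ℝ, 0 < C ∧ ∀ n : ℕ, 1 ≤ n →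
      |p n / q n - 4 / Real.pi| ≤ C * (1 + Real.sqrt 2) ^ (-(2 * (n : ℤ))) := by
  have hp' : ∀ n : ℕ, p (n + 2) = (2 * n + 5) * p (n + 1) + ((n : ℝ) + 2) ^ 2 * p n := by
    intro n
    rw [hp (n + 2) (by omega), Nat.add_sub_cancel, show n + 2 - 1 = n + 1 by omega]
    push_cast
    ring
  have hq' : ∀ n : ℕ, q (n + 2) = (2 * n + 5) * q (n + 1) + ((n : ℝ) + 2) ^ 2 * q n := by
    intro n
    rw [hq (n + 2) (by omega), Nat.add_sub_cancel, show n + 2 - 1 = n + 1 by omega]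
    push_cast
    ring
  have hpos : ∀ n, 0 < q n := fun n =>
    (denomLowerBound_pos n).trans_le (denomLowerBound_le hq0 hq1 hq' n)
  set D : ℕ → ℝ := fun n => (-1) ^ n * (q n - Real.pi / 4 * p n) with hD
  have hD0 : ∀ n, 0 ≤ D n := by
    intro n
    rw [hD]
    simp only [neg_one_pow_mul_sub_eq_factorial_mul_heineIntegral hp0 hq0 hp1 hq1 hp' hq' n]
    exact mul_nonneg (Nat.cast_nonneg _) (heineIntegral_nonneg _)
  refine ⟨4, by norm_num, fun n _ => ?_⟩
  have hpi := Real.pi_pos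
  have hqn := hpos n
  have hqn1 := hpos (n + 1)
  have hsign : ((-1 : ℝ) ^ n) * (-1) ^ n = 1 := by rw [← mul_pow]; norm_num
  have hcas : D n * q (n + 1) + D (n + 1) * q n =
      Real.pi / 4 * ((n + 1).factorial : ℝ) ^ 2 := by
    have h := casoratian_eq_neg_one_pow_mul_factorial_sq hp0 hq0 hp1 hq1 hp' hq' n
    simp only [hD, pow_succ (-1 : ℝ) n]
    linear_combination Real.pi / 4 * (-1) ^ n * h +
      Real.pi / 4 * ((n + 1).factorial : ℝ) ^ 2 * hsign
  have habs : |p n / q n - 4 / Real.pi| = 4 / Real.pi * (D n / q n) := by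
    have h1 : p n / q n - 4 / Real.pi = -((-1) ^ n * (4 / Real.pi * (D n / q n))) := by
      simp only [hD]
      field_simp
      linear_combination (4 * q n - Real.pi * p n) * hsign
    have h2 : 0 ≤ 4 / Real.pi * (D n / q n) := by have := hD0 n; positivity
    rw [h1, abs_neg, abs_mul, abs_pow, abs_neg, abs_one, one_pow, one_mul, abs_of_nonneg h2]
  have hDn : D n * q (n + 1) ≤ Real.pi / 4 * ((n + 1).factorial : ℝ) ^ 2 := by
    have := mul_nonneg (hD0 (n + 1)) hqn.le
    linarith
  have hmain := pow_mul_factorial_sq_le_mul hq0 hq1 hq' n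
  have hpow : (1 + √2) ^ (-(2 * (n : ℤ))) = ((1 + √2) ^ (2 * n))⁻¹ := by
    rw [zpow_neg]
    norm_cast
  rw [habs, hpow]
  calc 4 / Real.pi * (D n / q n)
      = 4 / Real.pi * (D n * q (n + 1)) / (q n * q (n + 1)) := by field_simp
    _ ≤ 4 / Real.pi * (Real.pi / 4 * ((n + 1).factorial : ℝ) ^ 2) / (q n * q (n + 1)) := by
      gcongr
    _ = ((n + 1).factorial : ℝ) ^ 2 / (q n * q (n + 1)) := by field_simp
    _ ≤ 4 * ((1 + √2) ^ (2 * n))⁻¹ := by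
      rw [← div_eq_mul_inv, div_le_div_iff₀ (by positivity) (by positivity)]
      linarith
end

section
/- Let a(n) = 2n+1, b(n) = (n+1)², and r(n) = (√2 − 1)·(n + 1/2), all as functions ℕ → ℝ. Then for every n ∈ ℕ, r(n)·(a(n+1) + r(n+1)) − b(n) = −1/4. -/
theorem bauer_muir_defect_pi
    (a b r : ℕ → ℝ)
    (ha : ∀ n : ℕ, a n = 2 * n + 1)
    (hb : ∀ n : ℕ, b n = ((n : ℝ) + 1) ^ 2)
    (hr : ∀ n : ℕ, r n = (Real.sqrt 2 - 1) * ((n : ℝ) + 1 / 2)) :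
    ∀ n : ℕ, r n * (a (n + 1) + r (n + 1)) - b n = -(1 / 4) := by
  intro n
  have h : Real.sqrt 2 ^ 2 = 2 := Real.sq_sqrt (by norm_num)
  rw [ha, hb, hr, hr]
  push_cast
  linear_combination ((n : ℝ) + 1 / 2) * ((n : ℝ) + 3 / 2) * h
end

section
/- Let ω = 1 + √2 and define, for n, l ∈ ℕ, r(n,l) = (ω−2)·(n − l + 1/2), d(n,l) = −(2l+1)²/4, a(n,l) = 2n + 1 + 2(ω−1)·l, b(n,l) = (n+1)², and R(n,l) = a(n,l) + r(n,l) (all real-valued; n−l is interpreted as the integer difference). Then for all n and l: (i) d(n,l) = r(n,l)·R(n+1,l) − b(n,l); (ii) for n ≥ 1, a(n,l+1) = R(n+1,l) − r(n−1,l)·d(n,l)/d(n−1,l); and (iii) b(n,l+1) = b(n,l)·d(n+1,l)/d(n,l). -/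
theorem iterated_bauer_muir_hierarchy_pi
    (ω : ℝ) (hω : ω = 1 + Real.sqrt 2)
    (r d a b R : ℕ → ℕ → ℝ)
    (hr : ∀ n l : ℕ, r n l = (ω - 2) * ((n : ℝ) - (l : ℝ) + 1 / 2))
    (hd : ∀ n l : ℕ, d n l = -((2 * (l : ℝ) + 1) ^ 2 / 4))
    (ha : ∀ n l : ℕ, a n l = 2 * n + 1 + 2 * (ω - 1) * l)
    (hb : ∀ n l : ℕ, b n l = ((n : ℝ) + 1) ^ 2)
    (hR : ∀ n l : ℕ, R n l = a n l + r n l) :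
    (∀ n l : ℕ, d n l = r n l * R (n + 1) l - b n l) ∧
    (∀ n l : ℕ, 1 ≤ n → a n (l + 1) = R (n + 1) l - r (n - 1) l * (d n l / d (n - 1) l)) ∧
    (∀ n l : ℕ, b n (l + 1) = b n l * (d (n + 1) l / d n l)) := by
  have hs : Real.sqrt 2 ^ 2 = 2 := Real.sq_sqrt (by norm_num)
  have hd_ratio : ∀ m n l : ℕ, d m l / d n l = 1 := fun m n l => by
    have hne : d n l ≠ 0 := by
      rw [hd]
      exact (neg_neg_of_pos (by positivity)).ne
    rw [show d m l = d n l by rw [hd, hd], div_self hne]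
  refine ⟨fun n l => ?_, fun n l hn => ?_, fun n l => ?_⟩
  · rw [hd, hR, hr, hr, ha, hb, hω]
    push_cast
    linear_combination (-((n : ℝ) - l + 1 / 2) * (n + l + 3 / 2)) * hs
  · rw [hd_ratio, hR, hr, hr, ha, ha]
    push_cast [Nat.cast_sub hn]
    ring
  · rw [hd_ratio, hb, hb, mul_one]
end

section
/- Let ω = 1 + √2 and for k ∈ ℕ set S k = −(k+2)²·(2k+1)²·(4k+1)·(4k+9), T k = 6(k+2)(2k+3)(4k+7), U k = (4k+5)(4k+7)(4k+9). Define p, q : ℕ → ℝ by p 0 = 1, q 0 = 1, p 1 = 8 + 20ω, q 1 = 8 + 15ω, and for all n ≥ 0, p (n+2) = (T n + ω·U n)·p (n+1) + S n·p n and q (n+2) = (T n + ω·U n)·q (n+1) + S n·q n. Then the sequence p n / q n converges to 4/π. -/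
/-- The integrals `∫₀¹ v²ᵏ (1 - v²)ᵏ⁺¹ / (x² + v²)ᵏ⁺² dv`, which are (up to scaling) Jacobi
functions of the second kind with parameters `(-3/2, 0)`. -/
noncomputable def jacobiIntegral (x : ℝ) (k : ℕ) : ℝ :=
  ∫ v in (0 : ℝ)..1, v ^ (2 * k) * (1 - v ^ 2) ^ (k + 1) / (x ^ 2 + v ^ 2) ^ (k + 2)

theorem intervalIntegrable_jacobiIntegrand {x : ℝ} (hx : 0 < x) (k : ℕ) :
    IntervalIntegrable
      (fun v : ℝ => v ^ (2 * k) * (1 - v ^ 2) ^ (k + 1) / (x ^ 2 + v ^ 2) ^ (k + 2))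
      MeasureTheory.volume 0 1 := by
  apply Continuous.intervalIntegrable
  refine Continuous.div (by fun_prop) (by fun_prop) fun v => ?_
  positivity

theorem hasDerivAt_jacobi_certificate {x : ℝ} (hx : 0 < x) (k : ℕ) (v : ℝ) :
    HasDerivAt
      (fun v : ℝ => v ^ (2 * k + 1) * (1 - v ^ 2) ^ (k + 2) *
        (((k : ℝ) + 2) * (4 * k + 9) * x ^ 2
          + (3 * (4 * k + 7) / 2 - (4 * k + 5) * (4 * k + 9) * x ^ 2 / 2) * v ^ 2
          - (k + 3) * (4 * k + 5) * v ^ 4) / (x ^ 2 + v ^ 2) ^ (k + 3))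
      (((k : ℝ) + 3) * (2 * k + 3) * (4 * k + 5) *
          (v ^ (2 * (k + 2)) * (1 - v ^ 2) ^ (k + 2 + 1) / (x ^ 2 + v ^ 2) ^ (k + 2 + 2))
        - (6 * ((k : ℝ) + 2) * (2 * k + 3) * (4 * k + 7)
            + (x ^ 2 - 1) / 2 * ((4 * k + 5) * (4 * k + 7) * (4 * k + 9))) *
          (v ^ (2 * (k + 1)) * (1 - v ^ 2) ^ (k + 1 + 1) / (x ^ 2 + v ^ 2) ^ (k + 1 + 2))
        + ((k : ℝ) + 2) * (2 * k + 1) * (4 * k + 9) *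
          (v ^ (2 * k) * (1 - v ^ 2) ^ (k + 1) / (x ^ 2 + v ^ 2) ^ (k + 2))) v := by
  have hz : x ^ 2 + v ^ 2 ≠ 0 := by positivity
  have hsq : HasDerivAt (fun v : ℝ => v ^ 2) (2 * v) v := by simpa using hasDerivAt_pow 2 v
  have h4 : HasDerivAt (fun v : ℝ => v ^ 4) (4 * v ^ 3) v := by simpa using hasDerivAt_pow 4 v
  have h1 := hasDerivAt_pow (2 * k + 1) v
  have h2 := (hsq.const_sub 1).fun_pow (k + 2)
  have h3 := ((hsq.const_mul (3 * (4 * (k : ℝ) + 7) / 2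
    - (4 * k + 5) * (4 * k + 9) * x ^ 2 / 2)).const_add
      (((k : ℝ) + 2) * (4 * k + 9) * x ^ 2)).fun_sub (h4.const_mul (((k : ℝ) + 3) * (4 * k + 5)))
  have h5 := (hsq.const_add (x ^ 2)).fun_pow (k + 3)
  refine (((h1.fun_mul h2).fun_mul h3).fun_div h5 (pow_ne_zero _ hz)).congr_deriv ?_
  simp only [show 2 * k + 1 - 1 = 2 * k by omega, show k + 2 - 1 = k + 1 by omega,
    show k + 3 - 1 = k + 2 by omega]
  simp only [pow_add, mul_add, pow_mul v 2 k]
  push_cast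
  field_simp
  ring

theorem jacobiIntegral_recurrence {x : ℝ} (hx : 0 < x) (k : ℕ) :
    ((k : ℝ) + 3) * (2 * k + 3) * (4 * k + 5) * jacobiIntegral x (k + 2)
      = (6 * ((k : ℝ) + 2) * (2 * k + 3) * (4 * k + 7)
            + (x ^ 2 - 1) / 2 * ((4 * k + 5) * (4 * k + 7) * (4 * k + 9)))
          * jacobiIntegral x (k + 1)
        - ((k : ℝ) + 2) * (2 * k + 1) * (4 * k + 9) * jacobiIntegral x k := by
  have i0 := intervalIntegrable_jacobiIntegrand hx k
  have i1 := intervalIntegrable_jacobiIntegrand hx (k + 1)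
  have i2 := intervalIntegrable_jacobiIntegrand hx (k + 2)
  have h := intervalIntegral.integral_eq_sub_of_hasDerivAt (a := 0) (b := 1)
    (fun v _ => hasDerivAt_jacobi_certificate hx k v)
    (((i2.const_mul _).sub (i1.const_mul _)).add (i0.const_mul _))
  rw [intervalIntegral.integral_add ((i2.const_mul _).sub (i1.const_mul _)) (i0.const_mul _),
    intervalIntegral.integral_sub (i2.const_mul _) (i1.const_mul _)] at h
  simp only [intervalIntegral.integral_const_mul] at h
  norm_num at h
  unfold jacobiIntegral
  linarith

theorem hasDerivAt_arctan_div {x : ℝ} (hx : 0 < x) (v : ℝ) :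
    HasDerivAt (fun v : ℝ => Real.arctan (v / x)) (x / (x ^ 2 + v ^ 2)) v := by
  have hz : x ^ 2 + v ^ 2 ≠ 0 := by positivity
  refine ((hasDerivAt_id v).div_const x).arctan.congr_deriv ?_
  simp only [id]
  field_simp

theorem hasDerivAt_div_sq_add_sq {x : ℝ} (hx : 0 < x) (v : ℝ) :
    HasDerivAt (fun v : ℝ => v / (x ^ 2 + v ^ 2))
      ((x ^ 2 - v ^ 2) / (x ^ 2 + v ^ 2) ^ 2) v := by
  have hz : x ^ 2 + v ^ 2 ≠ 0 := by positivity
  have hsq : HasDerivAt (fun v : ℝ => v ^ 2) (2 * v) v := by simpa using hasDerivAt_pow 2 v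
  refine ((hasDerivAt_id v).fun_div (hsq.const_add (x ^ 2)) hz).congr_deriv ?_
  simp only [id]
  field_simp
  ring

theorem hasDerivAt_div_sq_add_sq_sq {x : ℝ} (hx : 0 < x) (v : ℝ) :
    HasDerivAt (fun v : ℝ => v / (x ^ 2 + v ^ 2) ^ 2)
      ((x ^ 2 - 3 * v ^ 2) / (x ^ 2 + v ^ 2) ^ 3) v := by
  have hz : x ^ 2 + v ^ 2 ≠ 0 := by positivity
  have hsq : HasDerivAt (fun v : ℝ => v ^ 2) (2 * v) v := by simpa using hasDerivAt_pow 2 v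
  refine ((hasDerivAt_id v).fun_div ((hsq.const_add (x ^ 2)).fun_pow 2)
    (pow_ne_zero 2 hz)).congr_deriv ?_
  simp only [id]
  field_simp
  ring

theorem jacobiIntegral_zero {x : ℝ} (hx : 0 < x) :
    jacobiIntegral x 0
      = 1 / (2 * x ^ 2) - (x ^ 2 - 1) / (2 * x ^ 3) * Real.arctan (1 / x) := by
  have key : ∀ v : ℝ, HasDerivAt
      (fun v : ℝ => (1 + x ^ 2) / (2 * x ^ 2) * (v / (x ^ 2 + v ^ 2))
        - (x ^ 2 - 1) / (2 * x ^ 3) * Real.arctan (v / x))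
      (v ^ (2 * 0) * (1 - v ^ 2) ^ (0 + 1) / (x ^ 2 + v ^ 2) ^ (0 + 2)) v := by
    intro v
    have hz : x ^ 2 + v ^ 2 ≠ 0 := by positivity
    refine (((hasDerivAt_div_sq_add_sq hx v).const_mul _).fun_sub
      ((hasDerivAt_arctan_div hx v).const_mul _)).congr_deriv ?_
    field_simp
    ring
  have h := intervalIntegral.integral_eq_sub_of_hasDerivAt (a := 0) (b := 1)
    (fun v _ => key v) (intervalIntegrable_jacobiIntegrand hx 0)
  rw [jacobiIntegral, h]
  have hz : x ^ 2 + 1 ≠ 0 := by positivity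
  simp only [zero_div, Real.arctan_zero]
  field_simp
  ring

theorem jacobiIntegral_one {x : ℝ} (hx : 0 < x) :
    jacobiIntegral x 1
      = (1 + 15 * x ^ 2) / (8 * x ^ 2)
        + (1 - 6 * x ^ 2 - 15 * x ^ 4) / (8 * x ^ 3) * Real.arctan (1 / x) := by
  have key : ∀ v : ℝ, HasDerivAt
      (fun v : ℝ => v - (1 + x ^ 2) ^ 2 / 4 * (v / (x ^ 2 + v ^ 2) ^ 2)
        + (1 + 10 * x ^ 2 + 9 * x ^ 4) / (8 * x ^ 2) * (v / (x ^ 2 + v ^ 2))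
        + (1 - 6 * x ^ 2 - 15 * x ^ 4) / (8 * x ^ 3) * Real.arctan (v / x))
      (v ^ (2 * 1) * (1 - v ^ 2) ^ (1 + 1) / (x ^ 2 + v ^ 2) ^ (1 + 2)) v := by
    intro v
    have hz : x ^ 2 + v ^ 2 ≠ 0 := by positivity
    refine ((((hasDerivAt_id v).fun_sub ((hasDerivAt_div_sq_add_sq_sq hx v).const_mul _)).fun_add
      ((hasDerivAt_div_sq_add_sq hx v).const_mul _)).fun_add
      ((hasDerivAt_arctan_div hx v).const_mul _)).congr_deriv ?_
    field_simp
    ring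
  have h := intervalIntegral.integral_eq_sub_of_hasDerivAt (a := 0) (b := 1)
    (fun v _ => key v) (intervalIntegrable_jacobiIntegrand hx 1)
  rw [jacobiIntegral, h]
  have hz : x ^ 2 + 1 ≠ 0 := by positivity
  simp only [zero_div, Real.arctan_zero]
  field_simp
  ring

theorem jacobiIntegral_nonneg (x : ℝ) (k : ℕ) : 0 ≤ jacobiIntegral x k := by
  refine intervalIntegral.integral_nonneg zero_le_one fun v hv => ?_
  have : 0 ≤ 1 - v ^ 2 := by nlinarith [hv.1, hv.2]
  have := hv.1
  positivity

theorem jacobiIntegral_le {x : ℝ} (hx : 1 ≤ x) (k : ℕ) :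
    jacobiIntegral x k ≤ (1 / x ^ 2) ^ k := by
  have hx0 : 0 < x := by linarith
  have h : jacobiIntegral x k ≤ ∫ _ in (0 : ℝ)..1, (1 / x ^ 2) ^ k := by
    refine intervalIntegral.integral_mono_on zero_le_one
      (intervalIntegrable_jacobiIntegrand hx0 k) (by simp) fun v hv => ?_
    obtain ⟨hv0, hv1⟩ := hv
    have h1 : 0 ≤ 1 - v ^ 2 := by nlinarith
    have h2 : v ^ (2 * k) ≤ 1 := pow_le_one₀ hv0 hv1
    have h3 : (1 - v ^ 2) ^ (k + 1) ≤ 1 := pow_le_one₀ h1 (by nlinarith)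
    have h4 : (x ^ 2) ^ k ≤ (x ^ 2 + v ^ 2) ^ (k + 2) :=
      calc (x ^ 2) ^ k ≤ (x ^ 2) ^ (k + 2) := pow_le_pow_right₀ (by nlinarith) (by omega)
        _ ≤ _ := by gcongr; nlinarith
    rw [one_div_pow]
    exact div_le_div₀ zero_le_one (mul_le_one₀ h2 (by positivity) h3) (by positivity) h4
  simpa using h

theorem tendsto_jacobiIntegral {x : ℝ} (hx : 1 < x) :
    Filter.Tendsto (jacobiIntegral x) Filter.atTop (nhds 0) := by
  refine squeeze_zero (jacobiIntegral_nonneg x) (jacobiIntegral_le hx.le) ?_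
  refine tendsto_pow_atTop_nhds_zero_of_lt_one (by positivity) ?_
  rw [div_lt_one (by positivity)]
  nlinarith

theorem arctan_one_div_one_add_sqrt_two :
    Real.arctan (1 / (1 + Real.sqrt 2)) = Real.pi / 8 := by
  have h2 : Real.sqrt 2 ^ 2 = 2 := Real.sq_sqrt (by norm_num)
  have h1 : 1 < Real.sqrt 2 := by
    rw [Real.lt_sqrt] <;> norm_num
  have hlt : 1 / (1 + Real.sqrt 2) < 1 := by
    rw [div_lt_one] <;> linarith
  have hpos : 0 < 1 / (1 + Real.sqrt 2) := by positivity
  have h := Real.two_mul_arctan (x := 1 / (1 + Real.sqrt 2)) (by linarith) hlt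
  have h3 : 2 * (1 / (1 + Real.sqrt 2)) / (1 - (1 / (1 + Real.sqrt 2)) ^ 2) = 1 := by
    rw [div_eq_one_iff_eq (by nlinarith)]
    field_simp
    nlinarith
  rw [h3, Real.arctan_one] at h
  linarith

/-- The normalising factors relating the continued fraction recurrence to `jacobiIntegral`. -/
noncomputable def jacobiScale : ℕ → ℝ
  | 0 => 1
  | k + 1 => ((k : ℝ) + 2) * (2 * k + 1) * (4 * k + 1) * jacobiScale k

theorem jacobiScale_pos (k : ℕ) : 0 < jacobiScale k := by
  induction k with
  | zero => exact one_pos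
  | succ k ih => rw [jacobiScale]; positivity


theorem pi_accelerated_cf_convergents_tendsto
    (ω : ℝ) (hω : ω = 1 + Real.sqrt 2)
    (S T U : ℕ → ℝ)
    (hS : ∀ k : ℕ, S k = -((k : ℝ) + 2) ^ 2 * (2 * k + 1) ^ 2 * (4 * k + 1) * (4 * k + 9))
    (hT : ∀ k : ℕ, T k = 6 * ((k : ℝ) + 2) * (2 * k + 3) * (4 * k + 7))
    (hU : ∀ k : ℕ, U k = (4 * (k : ℝ) + 5) * (4 * k + 7) * (4 * k + 9))
    (p q : ℕ → ℝ)
    (hp0 : p 0 = 1) (hq0 : q 0 = 1)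
    (hp1 : p 1 = 8 + 20 * ω) (hq1 : q 1 = 8 + 15 * ω)
    (hp : ∀ n : ℕ, p (n + 2) = (T n + ω * U n) * p (n + 1) + S n * p n)
    (hq : ∀ n : ℕ, q (n + 2) = (T n + ω * U n) * q (n + 1) + S n * q n) :
    Filter.Tendsto (fun n => p n / q n) Filter.atTop (nhds (4 / Real.pi)) := by
  have hs2 : Real.sqrt 2 ^ 2 = 2 := Real.sq_sqrt (by norm_num)
  have hs1 : 1 < Real.sqrt 2 := by
    rw [Real.lt_sqrt] <;> norm_num
  have hw2 : ω ^ 2 = 2 * ω + 1 := by rw [hω]; linarith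
  have hw : 2 < ω := by linarith
  have hw0 : 0 < ω := by linarith
  have harc : Real.arctan (1 / ω) = Real.pi / 8 := by
    rw [hω]; exact arctan_one_div_one_add_sqrt_two
  have hrem : ∀ n, 4 * q n - Real.pi * p n = 8 * ω ^ 2 * (jacobiScale n * jacobiIntegral ω n) ∧
      4 * q (n + 1) - Real.pi * p (n + 1)
        = 8 * ω ^ 2 * (jacobiScale (n + 1) * jacobiIntegral ω (n + 1)) := by
    intro n
    induction n with
    | zero =>
      constructor
      · rw [jacobiIntegral_zero hw0, harc, hp0, hq0, jacobiScale]
        field_simp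
        rw [hw2]
        ring
      · rw [zero_add, jacobiIntegral_one hw0, harc, hp1, hq1, jacobiScale, jacobiScale]
        have hz : 1 + ω ^ 2 ≠ 0 := by positivity
        field_simp
        have e3 : ω ^ 3 = 5 * ω + 2 := by
          linear_combination (ω + 2) * hw2
        have e4 : ω ^ 4 = 12 * ω + 5 := by
          linear_combination (ω ^ 2 + 2 * ω + 5) * hw2
        push_cast
        ring_nf
        simp only [e3, e4, hw2]
        ring
    | succ n ih =>
      refine ⟨ih.2, ?_⟩
      have hrec := jacobiIntegral_recurrence hw0 n
      rw [show (ω ^ 2 - 1) / 2 = ω by linarith] at hrec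
      have s1 : jacobiScale (n + 1)
          = ((n : ℝ) + 2) * (2 * n + 1) * (4 * n + 1) * jacobiScale n := rfl
      have s2 : jacobiScale (n + 2)
          = ((n : ℝ) + 3) * (2 * n + 3) * (4 * n + 5) * jacobiScale (n + 1) := by
        rw [jacobiScale]; push_cast; ring
      have ih1 := ih.1
      have ih2 := ih.2
      rw [hp, hq, s2]
      rw [s1] at ih2 ⊢
      rw [hS, hT, hU]
      linear_combination
        (6 * ((n : ℝ) + 2) * (2 * n + 3) * (4 * n + 7)
          + ω * ((4 * n + 5) * (4 * n + 7) * (4 * n + 9))) * ih2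
        - ((n : ℝ) + 2) ^ 2 * (2 * n + 1) ^ 2 * (4 * n + 1) * (4 * n + 9) * ih1
        - 8 * ω ^ 2 * (((n : ℝ) + 2) * (2 * n + 1) * (4 * n + 1) * jacobiScale n) * hrec
  have hgrow : ∀ n, 0 < q n ∧ ((n : ℝ) + 2) * (2 * n + 1) * (4 * n + 1) * q n ≤ q (n + 1) := by
    intro n
    induction n with
    | zero =>
      rw [hq0, zero_add, hq1]
      norm_num
      linarith
    | succ n ih =>
      obtain ⟨h0, h1⟩ := ih
      have hpos : 0 < q (n + 1) := lt_of_lt_of_le (by positivity) h1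
      refine ⟨hpos, ?_⟩
      rw [hq, hS, hT, hU]
      have hn : (0 : ℝ) ≤ n := n.cast_nonneg
      have hA := mul_le_mul_of_nonneg_left h1
        (show (0 : ℝ) ≤ ((n : ℝ) + 2) * (2 * n + 1) * (4 * n + 9) by positivity)
      have hB : 0 ≤ (ω - 2) * ((4 * (n : ℝ) + 5) * (4 * n + 7) * (4 * n + 9)) * q (n + 1) :=
        mul_nonneg (mul_nonneg (by linarith) (by positivity)) hpos.le
      have hC : 0 ≤ (6 * ((n : ℝ) + 2) * (2 * n + 3) * (4 * n + 7)
          + 2 * ((4 * n + 5) * (4 * n + 7) * (4 * n + 9))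
          - ((n : ℝ) + 2) * (2 * n + 1) * (4 * n + 9)
          - ((n : ℝ) + 3) * (2 * n + 3) * (4 * n + 5)) * q (n + 1) := by
        refine mul_nonneg ?_ hpos.le
        ring_nf
        positivity
      push_cast
      linarith
  have hscale : ∀ n, jacobiScale n ≤ q n := by
    intro n
    induction n with
    | zero => rw [jacobiScale, hq0]
    | succ n ih =>
      refine le_trans ?_ (hgrow n).2
      rw [jacobiScale]
      gcongr
  have hpi := Real.pi_pos
  have hbound : ∀ n, |p n / q n - 4 / Real.pi|
      ≤ 8 * ω ^ 2 / Real.pi * jacobiIntegral ω n := by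
    intro n
    have hqn := (hgrow n).1
    have hJ := jacobiIntegral_nonneg ω n
    have hc := (jacobiScale_pos n).le
    have e : p n / q n - 4 / Real.pi
        = -(8 * ω ^ 2 / Real.pi * (jacobiScale n / q n * jacobiIntegral ω n)) := by
      have := (hrem n).1
      field_simp
      linarith
    rw [e, abs_neg, abs_of_nonneg (by positivity)]
    gcongr
    exact mul_le_of_le_one_left hJ ((div_le_one hqn).2 (hscale n))
  rw [tendsto_iff_norm_sub_tendsto_zero]
  refine squeeze_zero (fun _ => norm_nonneg _) hbound ?_
  simpa using (tendsto_jacobiIntegral (by linarith : 1 < ω)).const_mul (8 * ω ^ 2 / Real.pi)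
end

section
/- Let η = 3 + 2√2 and for k ∈ ℕ set S k = −(k+1)²·(2k+1)²·(4k−1)·(4k+7), T k = −2(4k+5)(6k²+15k+8), U k = 3(4k+3)(4k+5)(4k+7). Define p, q : ℕ → ℝ by p 0 = 0, q 0 = 1, p 1 = 6η, q 1 = −2 + 9η, p 2 = (T 0 + η·U 0)·p 1 − S 0·p 0, q 2 = (T 0 + η·U 0)·q 1 − S 0·q 0, and for all n ≥ 1, p (n+2) = (T n + η·U n)·p (n+1) + S n·p n and q (n+2) = (T n + η·U n)·q (n+1) + S n·q n. Then the sequence p n / q n converges to ln 2. -/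
/-! The convergents are those of the Legendre continued fraction of `4 * artanh (1 / η)`, taken at even
indices: up to a common nonzero factor, `q n` is the Legendre polynomial `P₂ₙ` at `η` and `p n` is
four times the associated numerator. The error is controlled by the Legendre function of the second
kind, written as an integral. -/

open Filter Topology

/-- The three-term recurrence of the Legendre functions at `x`. -/
def LegendreRec (x : ℝ) (f : ℕ → ℝ) : Prop :=
  ∀ m : ℕ, ((m : ℝ) + 2) * f (m + 2) = (2 * m + 3) * x * f (m + 1) - (m + 1) * f m

/-- The solution of the Legendre recurrence with prescribed initial values. -/
noncomputable def legendreSeq (x a b : ℝ) : ℕ → ℝ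
  | 0 => a
  | 1 => b
  | m + 2 => ((2 * m + 3) * x * legendreSeq x a b (m + 1) - (m + 1) * legendreSeq x a b m) / (m + 2)

theorem legendreRec_legendreSeq (x a b : ℝ) : LegendreRec x (legendreSeq x a b) := by
  intro m
  rw [legendreSeq, mul_div_cancel₀]
  positivity

namespace LegendreRec

variable {x : ℝ} {f g : ℕ → ℝ}

theorem sub (hf : LegendreRec x f) (hg : LegendreRec x g) :
    LegendreRec x (fun m => f m - g m) := by
  intro m
  linear_combination hf m - hg m

theorem mul_const (hf : LegendreRec x f) (c : ℝ) : LegendreRec x (fun m => f m * c) := by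
  intro m
  linear_combination c * hf m

theorem eq_of_initial (hf : LegendreRec x f) (hg : LegendreRec x g) (h0 : f 0 = g 0)
    (h1 : f 1 = g 1) (m : ℕ) : f m = g m := by
  induction m using Nat.twoStepInduction with
  | zero => exact h0
  | one => exact h1
  | more m ih₀ ih₁ =>
    have hm : (m : ℝ) + 2 ≠ 0 := by positivity
    apply mul_left_cancel₀ hm
    rw [hf m, hg m, ih₀, ih₁]

theorem pos_and_two_mul_le (hf : LegendreRec x f) (hx : 2 ≤ x) (h0 : 0 < f 0)
    (h1 : 2 * f 0 ≤ f 1) (m : ℕ) : 0 < f m ∧ 2 * f m ≤ f (m + 1) := by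
  induction m with
  | zero => exact ⟨h0, h1⟩
  | succ m ih =>
    obtain ⟨hpos, hle⟩ := ih
    have hpos' : 0 < f (m + 1) := by linarith
    refine ⟨hpos', ?_⟩
    have hm : (0 : ℝ) ≤ m := m.cast_nonneg
    have hx' : (2 * m + 3) * 2 * f (m + 1) ≤ (2 * m + 3) * x * f (m + 1) := by gcongr
    have hle' : ((m : ℝ) + 1) * (2 * f m) ≤ (m + 1) * f (m + 1) := by gcongr
    have hmf : 0 ≤ m * f (m + 1) := by positivity
    have hm2 : 0 < (m : ℝ) + 2 := by positivity
    refine le_of_mul_le_mul_left ?_ hm2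
    rw [show m + 1 + 1 = m + 2 from rfl, hf m]
    linarith

theorem tendsto_atTop (hf : LegendreRec x f) (hx : 2 ≤ x) (h0 : 0 < f 0) (h1 : 2 * f 0 ≤ f 1) :
    Tendsto f atTop atTop :=
  tendsto_atTop_of_geom_le h0 one_lt_two fun m => (hf.pos_and_two_mul_le hx h0 h1 m).2

/-- The recurrence satisfied by every second term of a solution. -/
theorem two_step (hf : LegendreRec x f) (m : ℕ) :
    ((m : ℝ) + 3) * (m + 4) * (2 * m + 3) * f (m + 4) =
      ((2 * m + 7) * (2 * m + 5) * (2 * m + 3) * x ^ 2 - (m + 3) ^ 2 * (2 * m + 3)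
        - (m + 2) ^ 2 * (2 * m + 7)) * f (m + 2)
      - (m + 2) * (m + 1) * (2 * m + 7) * f m := by
  have e₀ := hf m
  have e₁ := hf (m + 1)
  have e₂ := hf (m + 2)
  push_cast at e₁ e₂
  simp only [add_assoc] at e₁ e₂
  norm_num at e₁ e₂
  linear_combination (m + 3) * (2 * m + 3) * e₂ + (2 * m + 7) * (2 * m + 3) * x * e₁
    + (m + 2) * (2 * m + 7) * e₀

end LegendreRec

/-- The normalisation relating the accelerated recurrence to the Legendre recurrence. -/
def acceleratedFactor : ℕ → ℝ
  | 0 => 1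
  | n + 1 => (2 * n + 1) * (n + 1) * |4 * (n : ℝ) - 1| * acceleratedFactor n

theorem acceleratedFactor_one : acceleratedFactor 1 = 1 := by
  simp [acceleratedFactor]

theorem acceleratedFactor_add_two (n : ℕ) :
    acceleratedFactor (n + 2) =
      (2 * n + 3) * (n + 2) * (4 * n + 3) * acceleratedFactor (n + 1) := by
  have h : |4 * ((n + 1 : ℕ) : ℝ) - 1| = 4 * n + 3 := by
    rw [abs_of_nonneg] <;> push_cast <;> linarith [n.cast_nonneg (α := ℝ)]
  rw [acceleratedFactor, h]
  push_cast
  ring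

theorem acceleratedFactor_pos (n : ℕ) : 0 < acceleratedFactor n := by
  induction n using Nat.twoStepInduction with
  | zero => simp [acceleratedFactor]
  | one => simp [acceleratedFactor_one]
  | more n _ ih =>
    rw [acceleratedFactor_add_two]
    positivity

theorem LegendreRec.accelerated_step {x : ℝ} {f : ℕ → ℝ} (hf : LegendreRec x f)
    (hx : x ^ 2 = 6 * x - 1) (n : ℕ) :
    acceleratedFactor (n + 2) * f (2 * (n + 2)) =
      (-2 * (4 * (n : ℝ) + 5) * (6 * n ^ 2 + 15 * n + 8)
        + x * (3 * (4 * (n : ℝ) + 3) * (4 * n + 5) * (4 * n + 7)))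
        * (acceleratedFactor (n + 1) * f (2 * (n + 1)))
      - (n + 1) * (2 * n + 1) * (4 * n + 7) * acceleratedFactor (n + 1) * f (2 * n) := by
  have h := hf.two_step (2 * n)
  push_cast at h
  rw [hx] at h
  rw [acceleratedFactor_add_two, show 2 * (n + 2) = 2 * n + 4 by ring,
    show 2 * (n + 1) = 2 * n + 2 by ring]
  linear_combination acceleratedFactor (n + 1) / 2 * h

theorem LegendreRec.accelerated_eq {x : ℝ} {f : ℕ → ℝ} (hf : LegendreRec x f)
    (hx : x ^ 2 = 6 * x - 1) {S T U v : ℕ → ℝ}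
    (hS : ∀ k : ℕ, S k = -((k : ℝ) + 1) ^ 2 * (2 * k + 1) ^ 2 * (4 * k - 1) * (4 * k + 7))
    (hT : ∀ k : ℕ, T k = -2 * (4 * (k : ℝ) + 5) * (6 * k ^ 2 + 15 * k + 8))
    (hU : ∀ k : ℕ, U k = 3 * (4 * (k : ℝ) + 3) * (4 * k + 5) * (4 * k + 7))
    (h0 : v 0 = f 0) (h1 : v 1 = f 2) (h2 : v 2 = (T 0 + x * U 0) * v 1 - S 0 * v 0)
    (hv : ∀ n : ℕ, 1 ≤ n → v (n + 2) = (T n + x * U n) * v (n + 1) + S n * v n) (n : ℕ) :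
    v n = acceleratedFactor n * f (2 * n) := by
  induction n using Nat.twoStepInduction with
  | zero => simp [h0, acceleratedFactor]
  | one => simp [h1, acceleratedFactor_one]
  | more n ih₀ ih₁ =>
    rw [hf.accelerated_step hx n]
    rcases n with _ | n
    · rw [h2, hT, hU, hS, h1, h0]
      simp [acceleratedFactor_one]
    · rw [hv _ (by omega), ih₀, ih₁, hT, hU, hS, acceleratedFactor_add_two]
      push_cast
      ring

/-- The Legendre function of the second kind, as an integral. -/
noncomputable def legendreQ (x : ℝ) (m : ℕ) : ℝ :=
  (∫ t in (-1 : ℝ)..1, ((1 - t ^ 2) / (2 * (x - t))) ^ m / (x - t)) / 2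

theorem continuousOn_legendreQ_integrand {x : ℝ} (hx : 1 < x) (m : ℕ) :
    ContinuousOn (fun t : ℝ => ((1 - t ^ 2) / (2 * (x - t))) ^ m / (x - t))
      (Set.uIcc (-1) 1) := by
  rw [Set.uIcc_of_le (by norm_num)]
  have h : ∀ t ∈ Set.Icc (-1 : ℝ) 1, x - t ≠ 0 := fun t ht => by linarith [ht.2]
  have h' : ∀ t ∈ Set.Icc (-1 : ℝ) 1, 2 * (x - t) ≠ 0 := fun t ht =>
    mul_ne_zero two_ne_zero (h t ht)
  fun_prop (disch := assumption)

theorem intervalIntegrable_legendreQ_integrand {x : ℝ} (hx : 1 < x) (m : ℕ) :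
    IntervalIntegrable (fun t : ℝ => ((1 - t ^ 2) / (2 * (x - t))) ^ m / (x - t))
      MeasureTheory.volume (-1) 1 :=
  (continuousOn_legendreQ_integrand hx m).intervalIntegrable

theorem hasDerivAt_legendreQ_base {x t : ℝ} (h : x - t ≠ 0) :
    HasDerivAt (fun t : ℝ => (1 - t ^ 2) / (2 * (x - t)))
      ((1 - 2 * t * x + t ^ 2) / (2 * (x - t) ^ 2)) t := by
  have hn : HasDerivAt (fun t : ℝ => 1 - t ^ 2) (-(2 * t)) t := by
    simpa using (hasDerivAt_pow 2 t).const_sub 1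
  have hd : HasDerivAt (fun t : ℝ => 2 * (x - t)) (-2) t := by
    simpa using ((hasDerivAt_id t).const_sub x).const_mul 2
  refine (hn.div hd (mul_ne_zero two_ne_zero h)).congr_deriv ?_
  field_simp
  ring

theorem hasDerivAt_legendreQ_factor {x t : ℝ} (h : x - t ≠ 0) :
    HasDerivAt (fun t : ℝ => (1 - 2 * t * x + t ^ 2) / (2 * (x - t)))
      (((1 - t ^ 2) / (2 * (x - t)) - x) / (x - t)) t := by
  have hn : HasDerivAt (fun t : ℝ => 1 - 2 * t * x + t ^ 2) (-(2 * x) + 2 * t) t := by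
    have h₁ : HasDerivAt (fun t : ℝ => 2 * t * x) (2 * x) t := by
      simpa using ((hasDerivAt_id t).const_mul 2).mul_const x
    exact ((h₁.const_sub 1).add (hasDerivAt_pow 2 t)).congr_deriv (by simp)
  have hd : HasDerivAt (fun t : ℝ => 2 * (x - t)) (-2) t := by
    simpa using ((hasDerivAt_id t).const_sub x).const_mul 2
  refine (hn.div hd (mul_ne_zero two_ne_zero h)).congr_deriv ?_
  field_simp
  ring

theorem legendreQ_zero {x : ℝ} (hx : 1 < x) :
    legendreQ x 0 = Real.log ((x + 1) / (x - 1)) / 2 := by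
  have h : ∫ t in (-1 : ℝ)..1, ((1 - t ^ 2) / (2 * (x - t))) ^ 0 / (x - t)
      = -Real.log (x - 1) - -Real.log (x - -1) := by
    refine intervalIntegral.integral_eq_sub_of_hasDerivAt (f := fun t => -Real.log (x - t))
      (fun t ht => ?_) (intervalIntegrable_legendreQ_integrand hx 0)
    rw [Set.uIcc_of_le (by norm_num)] at ht
    have hne : x - t ≠ 0 := by linarith [ht.2]
    exact (((hasDerivAt_id t).const_sub x).log hne).neg.congr_deriv (by simp [neg_div])
  rw [legendreQ, h, Real.log_div (by linarith) (by linarith)]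
  ring_nf

theorem legendreQ_one {x : ℝ} (hx : 1 < x) : legendreQ x 1 = x * legendreQ x 0 - 1 := by
  have hi := fun m => intervalIntegrable_legendreQ_integrand hx m
  have h := intervalIntegral.integral_eq_sub_of_hasDerivAt
    (f := fun t => (1 - 2 * t * x + t ^ 2) / (2 * (x - t)))
    (f' := fun t => ((1 - t ^ 2) / (2 * (x - t))) ^ 1 / (x - t)
      - x * (((1 - t ^ 2) / (2 * (x - t))) ^ 0 / (x - t))) (a := -1) (b := 1)
    (fun t ht => ?_) ((hi 1).sub ((hi 0).const_mul x))
  · rw [intervalIntegral.integral_sub (hi 1) ((hi 0).const_mul x),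
      intervalIntegral.integral_const_mul] at h
    have h₁ : (1 - 2 * 1 * x + 1 ^ 2) / (2 * (x - 1)) = -1 := by
      rw [div_eq_iff (by linarith)]; ring
    have h₂ : (1 - 2 * (-1) * x + (-1) ^ 2) / (2 * (x - -1)) = 1 := by
      rw [div_eq_iff (by linarith)]; ring
    rw [h₁, h₂] at h
    simp only [legendreQ]
    linear_combination h / 2
  · rw [Set.uIcc_of_le (by norm_num)] at ht
    have hne : x - t ≠ 0 := by linarith [ht.2]
    refine (hasDerivAt_legendreQ_factor hne).congr_deriv ?_
    ring

theorem legendreRec_legendreQ {x : ℝ} (hx : 1 < x) : LegendreRec x (legendreQ x) := by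
  intro m
  have hi := fun m => intervalIntegrable_legendreQ_integrand hx m
  have hi' := (((hi (m + 2)).const_mul (m + 2)).sub ((hi (m + 1)).const_mul ((2 * m + 3) * x))).add
    ((hi m).const_mul (m + 1))
  have h := intervalIntegral.integral_eq_sub_of_hasDerivAt
    (f := fun t => ((1 - t ^ 2) / (2 * (x - t))) ^ (m + 1)
      * ((1 - 2 * t * x + t ^ 2) / (2 * (x - t)))) (fun t ht => ?_) hi'
  · rw [intervalIntegral.integral_add
        (((hi (m + 2)).const_mul _).sub ((hi (m + 1)).const_mul _)) ((hi m).const_mul _),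
      intervalIntegral.integral_sub ((hi (m + 2)).const_mul _) ((hi (m + 1)).const_mul _),
      intervalIntegral.integral_const_mul, intervalIntegral.integral_const_mul,
      intervalIntegral.integral_const_mul] at h
    norm_num at h
    simp only [legendreQ]
    linear_combination h / 2
  · rw [Set.uIcc_of_le (by norm_num)] at ht
    have hne : x - t ≠ 0 := by linarith [ht.2]
    refine (((hasDerivAt_legendreQ_base hne).pow (m + 1)).mul
      (hasDerivAt_legendreQ_factor hne)).congr_deriv ?_
    simp only [Pi.pow_apply, pow_succ, Nat.add_sub_cancel]
    push_cast
    generalize ((1 - t ^ 2) / (2 * (x - t))) ^ m = w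
    field_simp
    ring

theorem abs_legendreQ_le_one {x : ℝ} (hx : 2 ≤ x) (m : ℕ) : |legendreQ x m| ≤ 1 := by
  have h := intervalIntegral.norm_integral_le_of_norm_le_const (a := -1) (b := 1) (C := 1)
    (f := fun t : ℝ => ((1 - t ^ 2) / (2 * (x - t))) ^ m / (x - t)) (fun t ht => ?_)
  · rw [legendreQ, abs_div, abs_two]
    norm_num at h
    linarith
  · rw [Set.uIoc_of_le (by norm_num)] at ht
    have hxt : 1 ≤ x - t := by linarith [ht.2]
    have hnum : 0 ≤ 1 - t ^ 2 := by nlinarith [ht.1, ht.2]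
    have hbase : 0 ≤ (1 - t ^ 2) / (2 * (x - t)) := by positivity
    rw [Real.norm_of_nonneg (by positivity)]
    refine div_le_one_of_le₀ (le_trans (pow_le_one₀ hbase ?_) hxt) (by linarith)
    exact div_le_one_of_le₀ (by nlinarith [sq_nonneg t]) (by linarith)

theorem legendreQ_eq {x : ℝ} (hx : 1 < x) (m : ℕ) :
    legendreQ x m = legendreSeq x 1 x m * legendreQ x 0 - legendreSeq x 0 1 m := by
  refine (legendreRec_legendreQ hx).eq_of_initial
    (((legendreRec_legendreSeq x 1 x).mul_const _).sub (legendreRec_legendreSeq x 0 1)) ?_ ?_ m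
  · simp [legendreSeq]
  · simp [legendreSeq, legendreQ_one hx]

/-- Convergence of the Legendre continued fraction. -/
theorem tendsto_legendreSeq_div {x : ℝ} (hx : 2 ≤ x) :
    Tendsto (fun m => legendreSeq x 0 1 m / legendreSeq x 1 x m) atTop (𝓝 (legendreQ x 0)) := by
  have hP := legendreRec_legendreSeq x 1 x
  have h0 : 0 < legendreSeq x 1 x 0 := by simp [legendreSeq]
  have h1 : 2 * legendreSeq x 1 x 0 ≤ legendreSeq x 1 x 1 := by simpa [legendreSeq] using hx
  have herr : Tendsto (fun m => (legendreSeq x 1 x m)⁻¹ * legendreQ x m) atTop (𝓝 0) :=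
    (hP.tendsto_atTop hx h0 h1).inv_tendsto_atTop.zero_mul_isBoundedUnder_le
      (isBoundedUnder_of ⟨1, fun m => abs_legendreQ_le_one hx m⟩)
  have hlim := herr.const_sub (legendreQ x 0)
  rw [sub_zero] at hlim
  refine hlim.congr fun m => ?_
  have hne := (hP.pos_and_two_mul_le hx h0 h1 m).1.ne'
  rw [legendreQ_eq (by linarith) m]
  field_simp
  ring

theorem four_mul_legendreQ_zero_eq_log_two :
    4 * legendreQ (3 + 2 * Real.sqrt 2) 0 = Real.log 2 := by
  have hs : Real.sqrt 2 ^ 2 = 2 := Real.sq_sqrt zero_le_two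
  have hpos : 0 < Real.sqrt 2 := by positivity
  have hquot : (3 + 2 * Real.sqrt 2 + 1) / (3 + 2 * Real.sqrt 2 - 1) = Real.sqrt 2 := by
    rw [div_eq_iff (by linarith)]
    linear_combination -2 * hs
  rw [legendreQ_zero (by linarith), hquot, Real.log_sqrt zero_le_two]
  ring


theorem log_two_accelerated_cf_convergents_tendsto
    (η : ℝ) (hη : η = 3 + 2 * Real.sqrt 2)
    (S T U : ℕ → ℝ)
    (hS : ∀ k : ℕ, S k = -((k : ℝ) + 1) ^ 2 * (2 * k + 1) ^ 2 * (4 * k - 1) * (4 * k + 7))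
    (hT : ∀ k : ℕ, T k = -2 * (4 * (k : ℝ) + 5) * (6 * k ^ 2 + 15 * k + 8))
    (hU : ∀ k : ℕ, U k = 3 * (4 * (k : ℝ) + 3) * (4 * k + 5) * (4 * k + 7))
    (p q : ℕ → ℝ)
    (hp0 : p 0 = 0) (hq0 : q 0 = 1)
    (hp1 : p 1 = 6 * η) (hq1 : q 1 = -2 + 9 * η)
    (hp2 : p 2 = (T 0 + η * U 0) * p 1 - S 0 * p 0)
    (hq2 : q 2 = (T 0 + η * U 0) * q 1 - S 0 * q 0)
    (hp : ∀ n : ℕ, 1 ≤ n → p (n + 2) = (T n + η * U n) * p (n + 1) + S n * p n)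
    (hq : ∀ n : ℕ, 1 ≤ n → q (n + 2) = (T n + η * U n) * q (n + 1) + S n * q n) :
    Filter.Tendsto (fun n => p n / q n) Filter.atTop (nhds (Real.log 2)) := by
  have hs : Real.sqrt 2 ^ 2 = 2 := Real.sq_sqrt zero_le_two
  have hx : η ^ 2 = 6 * η - 1 := by
    rw [hη]
    linear_combination 4 * hs
  have hη2 : 2 ≤ η := by
    rw [hη]
    linarith [Real.sqrt_nonneg 2]
  have hden := (legendreRec_legendreSeq η 1 η).accelerated_eq hx hS hT hU (v := q)
    (by simp [hq0, legendreSeq])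
    (by simp only [hq1, legendreSeq]; norm_num; linear_combination (-3 / 2) * hx) hq2 hq
  have hnum := ((legendreRec_legendreSeq η 0 1).mul_const 4).accelerated_eq hx hS hT hU (v := p)
    (by simp [hp0, legendreSeq]) (by simp only [hp1, legendreSeq]; norm_num; ring) hp2 hp
  have hlim := ((tendsto_legendreSeq_div hη2).comp
    (tendsto_id.const_mul_atTop' (zero_lt_two (α := ℕ)))).const_mul 4
  rw [hη, four_mul_legendreQ_zero_eq_log_two, ← hη] at hlim
  refine hlim.congr fun n => ?_
  rw [hnum, hden, mul_div_mul_left _ _ (acceleratedFactor_pos n).ne', mul_div_right_comm, mul_comm]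
  rfl
end

section
/- Let ω = 1 + √2 and define, for n, l ∈ ℕ, R(n,l) = 2n + 1 + 2(ω−1)·l + (ω−2)·(n − l + 1/2), d(n,l) = −(2l+1)²/4, b(n,l) = (n+1)² (with n − l the integer difference). Suppose W₀ : ℕ → ℝ satisfies, for all n, W₀(n) = R(n+1,n) + (−d(n+1,n))/(R(n+2,n) + b(n+1,n+1)/W₀(n+1)), where W₀(n+1) ≠ 0 and R(n+2,n) + b(n+1,n+1)/W₀(n+1) ≠ 0 for all n. Define W₂(n) = ω·(4n+1)·(4n+5)·(W₀(n) − (4n+3) − 2(n+1)(5n+4)/(ω·(4n+5))). Then for all n with T n + ω·U n + W₂(n+1) ≠ 0, W₂(n) = S n/(T n + ω·U n + W₂(n+1)), where S n = −(n+2)²(2n+1)²(4n+1)(4n+9), T n = 6(n+2)(2n+3)(4n+7), U n = (4n+5)(4n+7)(4n+9). -/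
theorem diagonal_tail_contraction_pi
    (ω : ℝ) (hω : ω = 1 + Real.sqrt 2)
    (R d b : ℕ → ℕ → ℝ)
    (hR : ∀ n l : ℕ, R n l = 2 * n + 1 + 2 * (ω - 1) * l + (ω - 2) * ((n : ℝ) - (l : ℝ) + 1 / 2))
    (hd : ∀ n l : ℕ, d n l = -((2 * (l : ℝ) + 1) ^ 2 / 4))
    (hb : ∀ n l : ℕ, b n l = ((n : ℝ) + 1) ^ 2)
    (S T U : ℕ → ℝ)
    (hS : ∀ n : ℕ, S n = -((n : ℝ) + 2) ^ 2 * (2 * n + 1) ^ 2 * (4 * n + 1) * (4 * n + 9))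
    (hT : ∀ n : ℕ, T n = 6 * ((n : ℝ) + 2) * (2 * n + 3) * (4 * n + 7))
    (hU : ∀ n : ℕ, U n = (4 * (n : ℝ) + 5) * (4 * n + 7) * (4 * n + 9))
    (W₀ W₂ : ℕ → ℝ)
    (hW₀ne : ∀ n : ℕ, W₀ (n + 1) ≠ 0)
    (hdenne : ∀ n : ℕ, R (n + 2) n + b (n + 1) (n + 1) / W₀ (n + 1) ≠ 0)
    (hW₀ : ∀ n : ℕ,
      W₀ n = R (n + 1) n + (-(d (n + 1) n)) / (R (n + 2) n + b (n + 1) (n + 1) / W₀ (n + 1)))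
    (hW₂ : ∀ n : ℕ,
      W₂ n = ω * (4 * n + 1) * (4 * n + 5) *
        (W₀ n - (4 * n + 3) - 2 * (n + 1) * (5 * n + 4) / (ω * (4 * n + 5)))) :
    ∀ n : ℕ, T n + ω * U n + W₂ (n + 1) ≠ 0 →
      W₂ n = S n / (T n + ω * U n + W₂ (n + 1)) := by
  have hω2 : ω ^ 2 = 2 * ω + 1 := by
    have h2 : Real.sqrt 2 ^ 2 = 2 := Real.sq_sqrt (by norm_num)
    rw [hω]
    linear_combination h2
  have hω0 : ω ≠ 0 := by
    rw [hω]
    positivity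
  have hW₂' : ∀ n : ℕ, W₂ n = (4 * n + 1) *
      (ω * (4 * n + 5) * (W₀ n - (4 * n + 3)) - 2 * (n + 1) * (5 * n + 4)) := by
    intro n
    have h5 : (4 * (n : ℝ) + 5) ≠ 0 := by positivity
    rw [hW₂]
    field_simp
  intro n hD
  have hV := hW₀ne n
  have hR₁ : R (n + 1) n = ω * (4 * n + 3) / 2 := by
    rw [hR]
    push_cast
    ring
  have hR₂ : R (n + 2) n = ω * (4 * n + 5) / 2 := by
    rw [hR]
    push_cast
    ring
  have hW := hW₀ n
  have hq := hdenne n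
  have hnext := hW₂' (n + 1)
  rw [hR₁, hR₂, hb, hd] at hW
  rw [hR₂, hb] at hq
  push_cast at hW hq hnext
  set V := W₀ (n + 1)
  set Q : ℝ := ω * (4 * n + 5) * V / 2 + (n + 2) ^ 2 with hQ
  have hden : ω * (4 * n + 5) / 2 + ((n : ℝ) + 1 + 1) ^ 2 / V = Q / V := by
    rw [hQ]
    field_simp
    ring
  rw [hden] at hq hW
  have hQ0 : Q ≠ 0 := fun h => hq (by rw [h, zero_div])
  have hD' : T n + ω * U n + W₂ (n + 1) = 2 * (4 * n + 9) * Q := by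
    rw [hT, hU, hnext, hQ]
    ring
  have hWQ : W₀ n * Q = ω * (4 * n + 3) / 2 * Q + (2 * n + 1) ^ 2 / 4 * V := by
    rw [hW]
    field_simp
  have hW₂Q : W₂ n * Q = -((4 * n + 1) * (n + 2) ^ 2 * (2 * n + 1) ^ 2 / 2) := by
    rw [hW₂']
    linear_combination (4 * n + 1) * ω * (4 * n + 5) * hWQ
      + (4 * n + 1) * (4 * n + 5) * (4 * n + 3) / 2 * Q * hω2
  rw [eq_div_iff hD, hD', hS]
  linear_combination 2 * (4 * n + 9) * hW₂Q
end
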